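/- arXiv:1111.6082 — 4 statements merged into one kernel-verified Lean document; each statement's English description precedes it below -/
import Mathlib

section
/- Let w ∈ ℝ^d, 0 < δ < 1 and η > 0. Define the sequence x_1, x_2, … in ℝ^d by the recursion x_{t+1} = x_t − η(1−δ)w (the online gradient descent update for the modified loss f(x) + δ[g(x)]_+ with f(x) = ⟨w,x⟩ and g(x) = 1 − ⟨w,x⟩ at an infeasible point). If ⟨w, x_1⟩ < 1, then ⟨w, x_{t+1}⟩ ≤ ⟨w, x_t⟩ < 1 for every t ≥ 1 (so every iterate violates the constraint g(x) ≤ 0), and consequently ∑_{t=1}^T [1 − ⟨w, x_t⟩]_+ ≥ T·(1 − ⟨w, x_1⟩) for every T ≥ 1, i.e., the cumulative violation of the constraint grows at least linearly in T. -/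
open RealInnerProductSpace Finset

/-- For the OGD recursion `x_{t+1} = x_t − η(1−δ)w` (gradient descent on the
modified loss `⟨w,x⟩ + δ[1 − ⟨w,x⟩]_+` at an infeasible point), starting from a point with
`⟨w, x_1⟩ < 1`, every iterate violates the constraint and the cumulative violation grows
at least linearly in `T`. -/
theorem stmt0 {d : ℕ} (w : EuclideanSpace ℝ (Fin d)) (δ η : ℝ)
    (hδ0 : 0 < δ) (hδ1 : δ < 1) (hη : 0 < η)
    (x : ℕ → EuclideanSpace ℝ (Fin d))
    (hrec : ∀ t : ℕ, x (t + 1) = x t - (η * (1 - δ)) • w)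
    (hinit : ⟪w, x 1⟫ < 1) :
    (∀ t : ℕ, 1 ≤ t → ⟪w, x (t + 1)⟫ ≤ ⟪w, x t⟫ ∧ ⟪w, x t⟫ < 1) ∧
    (∀ T : ℕ, 1 ≤ T →
      (T : ℝ) * (1 - ⟪w, x 1⟫) ≤ ∑ t ∈ Finset.Icc 1 T, max 0 (1 - ⟪w, x t⟫)) := by
  have hstep : ∀ t : ℕ, ⟪w, x (t + 1)⟫ ≤ ⟪w, x t⟫ := by
    intro t
    rw [hrec t, inner_sub_right, real_inner_smul_right]
    have hcoef : 0 ≤ η * (1 - δ) := mul_nonneg hη.le (sub_nonneg.mpr hδ1.le)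
    exact sub_le_self _ (mul_nonneg hcoef real_inner_self_nonneg)
  have hanti : Antitone fun t => ⟪w, x t⟫ := antitone_nat_of_succ_le hstep
  refine ⟨fun t ht => ⟨hstep t, (hanti ht).trans_lt hinit⟩, fun T _ => ?_⟩
  have hsum : (Icc 1 T).card • (1 - ⟪w, x 1⟫) ≤ ∑ t ∈ Icc 1 T, max 0 (1 - ⟪w, x t⟫) :=
    card_nsmul_le_sum _ _ _ fun t ht =>
      (sub_le_sub_left (hanti (mem_Icc.mp ht).1) 1).trans (le_max_right _ _)
  simpa only [Nat.card_Icc, Nat.add_sub_cancel, nsmul_eq_mul] using hsum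
end

section
/- Let 𝓑 ⊆ ℝ^d be nonempty, closed and convex, let Λ = [0,∞)^m ⊆ ℝ^m, let η > 0, and let L : ℝ^d × ℝ^m → ℝ be a differentiable convex-concave function. Given (x_t, λ_t) ∈ 𝓑 × Λ, define x_{t+1} = Π_𝓑(x_t − η ∇_x L(x_t, λ_t)) and λ_{t+1} = Π_Λ(λ_t + η ∇_λ L(x_t, λ_t)). Then for every (x, λ) ∈ 𝓑 × Λ: L(x_t, λ) − L(x, λ_t) ≤ (1/(2η))(‖x − x_t‖² + ‖λ − λ_t‖² − ‖x − x_{t+1}‖² − ‖λ − λ_{t+1}‖²) + (η/2)(‖∇_x L(x_t, λ_t)‖² + ‖∇_λ L(x_t, λ_t)‖²). -/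
open RealInnerProductSpace

/-- `p` is the Euclidean (metric) projection of `y` onto the set `C`. -/
def IsProjOn {E : Type*} [NormedAddCommGroup E] (C : Set E) (y p : E) : Prop :=
  p ∈ C ∧ ∀ z ∈ C, ‖p - y‖ ≤ ‖z - y‖

section ProjectedGradient

variable {E : Type*} [NormedAddCommGroup E] [InnerProductSpace ℝ E]

/-- First-order lower bound for a convex function with a gradient. -/
lemma ConvexOn.inner_gradient_le [CompleteSpace E] {f : E → ℝ} (hf : ConvexOn ℝ Set.univ f)
    {g x : E} (hg : HasGradientAt f g x) (y : E) : ⟪g, y - x⟫ ≤ f y - f x := by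
  have hconv : ConvexOn ℝ Set.univ (f ∘ AffineMap.lineMap (k := ℝ) x y) :=
    hf.comp_affineMap _
  have hderiv : HasDerivAt (f ∘ AffineMap.lineMap (k := ℝ) x y) ⟪g, y - x⟫ 0 := by
    have hline : HasDerivAt (AffineMap.lineMap (k := ℝ) x y) (y - x) (0 : ℝ) :=
      AffineMap.hasDerivAt_lineMap
    have hfx : HasFDerivAt f (InnerProductSpace.toDual ℝ E g)
        (AffineMap.lineMap x y (0 : ℝ)) := by
      simpa using hg.hasFDerivAt
    simpa using hfx.comp_hasDerivAt (0 : ℝ) hline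
  have h := hconv.le_slope_of_hasDerivAt (Set.mem_univ 0) (Set.mem_univ 1) one_pos hderiv
  simpa [slope_def_field] using h

/-- The variational inequality for the metric projection onto a convex set. -/
lemma IsProjOn.inner_le_zero {C : Set E} (hC : Convex ℝ C) {y p z : E}
    (hp : IsProjOn C y p) (hz : z ∈ C) : ⟪y - p, z - p⟫ ≤ 0 := by
  refine (norm_eq_iInf_iff_real_inner_le_zero hC hp.1).1 ?_ z hz
  have : Nonempty C := ⟨⟨p, hp.1⟩⟩
  refine le_antisymm (le_ciInf fun w => ?_) (ciInf_le (f := fun w : C => ‖y - w‖) ?_ ⟨p, hp.1⟩)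
  · simpa only [norm_sub_rev y] using hp.2 w w.2
  · exact ⟨0, Set.forall_mem_range.2 fun w => norm_nonneg _⟩

/-- The basic inequality for one projected gradient step. -/
lemma IsProjOn.two_mul_inner_le {C : Set E} (hC : Convex ℝ C) {η : ℝ} {x g p z : E}
    (hp : IsProjOn C (x - η • g) p) (hz : z ∈ C) :
    2 * η * ⟪g, x - z⟫ ≤ ‖z - x‖ ^ 2 - ‖z - p‖ ^ 2 + η ^ 2 * ‖g‖ ^ 2 := by
  have hvar := hp.inner_le_zero hC hz
  have hsq : ‖z - (x - η • g)‖ ^ 2 = ‖z - p‖ ^ 2 - 2 * ⟪x - η • g - p, z - p⟫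
      + ‖x - η • g - p‖ ^ 2 := by
    rw [← sub_sub_sub_cancel_right z (x - η • g) p, norm_sub_sq_real, real_inner_comm]
  have hexp : ‖z - (x - η • g)‖ ^ 2 = ‖z - x‖ ^ 2 - 2 * η * ⟪g, x - z⟫
      + η ^ 2 * ‖g‖ ^ 2 := by
    rw [← sub_add, norm_add_sq_real, norm_smul, mul_pow, Real.norm_eq_abs, sq_abs,
      real_inner_smul_right, ← neg_sub x z, inner_neg_left, real_inner_comm, norm_neg]
    ring
  nlinarith [sq_nonneg ‖x - η • g - p‖]

end ProjectedGradient

/-- Lemma 1 of the paper. One step of projected primal-descent /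
dual-ascent on a differentiable convex-concave function `L` satisfies the basic inequality. -/
theorem stmt1 {d m : ℕ} (𝓑 : Set (EuclideanSpace ℝ (Fin d)))
    (h𝓑ne : 𝓑.Nonempty) (h𝓑cl : IsClosed 𝓑) (h𝓑cv : Convex ℝ 𝓑)
    (η : ℝ) (hη : 0 < η)
    (L : EuclideanSpace ℝ (Fin d) → EuclideanSpace ℝ (Fin m) → ℝ)
    (hLconv : ∀ lam, ConvexOn ℝ Set.univ (fun x => L x lam))
    (hLconc : ∀ x, ConcaveOn ℝ Set.univ (fun lam => L x lam))
    (gx : EuclideanSpace ℝ (Fin d) → EuclideanSpace ℝ (Fin m) → EuclideanSpace ℝ (Fin d))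
    (gl : EuclideanSpace ℝ (Fin d) → EuclideanSpace ℝ (Fin m) → EuclideanSpace ℝ (Fin m))
    (hgx : ∀ x lam, HasGradientAt (fun y => L y lam) (gx x lam) x)
    (hgl : ∀ x lam, HasGradientAt (fun mu => L x mu) (gl x lam) lam)
    (xt : EuclideanSpace ℝ (Fin d)) (lamt : EuclideanSpace ℝ (Fin m))
    (hxt : xt ∈ 𝓑) (hlamt : ∀ i, 0 ≤ lamt i)
    (xt1 : EuclideanSpace ℝ (Fin d)) (lamt1 : EuclideanSpace ℝ (Fin m))
    (hxt1 : IsProjOn 𝓑 (xt - η • gx xt lamt) xt1)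
    (hlamt1 : IsProjOn {mu : EuclideanSpace ℝ (Fin m) | ∀ i, 0 ≤ mu i}
      (lamt + η • gl xt lamt) lamt1) :
    ∀ x ∈ 𝓑, ∀ lam : EuclideanSpace ℝ (Fin m), (∀ i, 0 ≤ lam i) →
      L xt lam - L x lamt ≤
        1 / (2 * η) * (‖x - xt‖ ^ 2 + ‖lam - lamt‖ ^ 2
          - ‖x - xt1‖ ^ 2 - ‖lam - lamt1‖ ^ 2)
        + η / 2 * (‖gx xt lamt‖ ^ 2 + ‖gl xt lamt‖ ^ 2) := by
  intro x hx lam hlam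
  have hcone : Convex ℝ {mu : EuclideanSpace ℝ (Fin m) | ∀ i, 0 ≤ mu i} := by
    intro u hu v hv a b ha hb _ i
    simpa using add_nonneg (mul_nonneg ha (hu i)) (mul_nonneg hb (hv i))
  have hprimal := (hLconv lamt).inner_gradient_le (hgx xt lamt) x
  have hdual : L xt lam - L xt lamt ≤ ⟪gl xt lamt, lam - lamt⟫ := by
    have hneg : HasGradientAt (-fun mu => L xt mu) (-gl xt lamt) lamt := by
      rw [hasGradientAt_iff_hasFDerivAt, map_neg]
      exact (hgl xt lamt).hasFDerivAt.neg
    have h := (hLconc xt).neg.inner_gradient_le hneg lam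
    simp only [inner_neg_left, Pi.neg_apply] at h
    linarith
  have hstepx := hxt1.two_mul_inner_le h𝓑cv hx
  have hstepl : 2 * η * ⟪gl xt lamt, lam - lamt⟫ ≤
      ‖lam - lamt‖ ^ 2 - ‖lam - lamt1‖ ^ 2 + η ^ 2 * ‖gl xt lamt‖ ^ 2 := by
    have hproj : IsProjOn {mu : EuclideanSpace ℝ (Fin m) | ∀ i, 0 ≤ mu i}
        (lamt - η • -gl xt lamt) lamt1 := by
      simpa using hlamt1
    simpa [← inner_neg_right] using hproj.two_mul_inner_le hcone hlam
  rw [← neg_sub x xt, inner_neg_right] at hstepx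
  have hgap : L xt lam - L x lamt ≤
      ⟪gl xt lamt, lam - lamt⟫ - ⟪gx xt lamt, x - xt⟫ := by
    linarith
  have hscaled := mul_le_mul_of_nonneg_left hgap (by positivity : 0 ≤ 2 * η)
  refine le_of_mul_le_mul_left (hscaled.trans ?_) (by positivity : 0 < 2 * η)
  have hrhs : ∀ a b : ℝ, 2 * η * (1 / (2 * η) * a + η / 2 * b) = a + η ^ 2 * b := by
    intro a b
    field_simp
  rw [hrhs]
  linarith
end

section
/- Let x_t, λ_t (t = 1,…,T) be the sequences produced by Algorithm 1. Then for every x ∈ B and every λ ∈ [0,∞)^m: ∑_{t=1}^T (L_t(x_t, λ) − L_t(x, λ_t)) ≤ (R² + ‖λ‖²)/(2η) + (ηT/2)((m+1)G² + 2mD²) + (η/2)((m+1)G² + 2mδ²η²) ∑_{t=1}^T ‖λ_t‖². -/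
open RealInnerProductSpace Finset

/-- Projecting onto a convex set does not increase the distance to any point of that set. -/
theorem IsProjOn.norm_sub_le {E : Type*} [NormedAddCommGroup E] [InnerProductSpace ℝ E]
    {C : Set E} (hC : Convex ℝ C) {y p : E} (h : IsProjOn C y p) {z : E} (hz : z ∈ C) :
    ‖p - z‖ ≤ ‖y - z‖ := by
  have : Nonempty C := ⟨⟨p, h.1⟩⟩
  have hinf : ‖y - p‖ = ⨅ w : C, ‖y - w‖ := by
    apply le_antisymm
    · refine le_ciInf fun w => ?_
      rw [norm_sub_rev y p, norm_sub_rev y w]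
      exact h.2 w w.2
    · exact ciInf_le ⟨0, by rintro _ ⟨w, rfl⟩; exact norm_nonneg _⟩ (⟨p, h.1⟩ : C)
  have hin := (norm_eq_iInf_iff_real_inner_le_zero hC h.1).1 hinf z hz
  have hsq : ‖y - z‖ ^ 2 = ‖y - p‖ ^ 2 - 2 * ⟪y - p, z - p⟫ + ‖p - z‖ ^ 2 := by
    rw [norm_sub_rev p z, ← norm_sub_sq_real, sub_sub_sub_cancel_right]
  refine le_of_sq_le_sq ?_ (norm_nonneg _)
  nlinarith [sq_nonneg ‖y - p‖]

/-- A convex function lies above its tangent hyperplanes. -/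
theorem ConvexOn.sub_le_inner_of_hasGradientAt {E : Type*} [NormedAddCommGroup E]
    [InnerProductSpace ℝ E] [CompleteSpace E] {f : E → ℝ} (hf : ConvexOn ℝ Set.univ f)
    {v x : E} (hv : HasGradientAt f v x) (y : E) : f x - f y ≤ ⟪v, x - y⟫ := by
  have hline : HasDerivAt (fun s : ℝ => AffineMap.lineMap x y s) (y - x) 0 :=
    AffineMap.hasDerivAt_lineMap
  have hφ : ConvexOn ℝ Set.univ (fun s : ℝ => f (AffineMap.lineMap x y s)) :=
    hf.comp_affineMap (AffineMap.lineMap x y)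
  have hd : HasDerivAt (fun s : ℝ => f (AffineMap.lineMap x y s)) ⟪v, y - x⟫ 0 := by
    have h0 : HasFDerivAt f (InnerProductSpace.toDual ℝ E v) (AffineMap.lineMap x y (0 : ℝ)) := by
      simpa using hv.hasFDerivAt
    rw [← InnerProductSpace.toDual_apply_apply]
    exact h0.comp_hasDerivAt (0 : ℝ) hline
  have h := hφ.le_slope_of_hasDerivAt (Set.mem_univ 0) (Set.mem_univ 1) one_pos hd
  rw [slope_def_field] at h
  simp only [AffineMap.lineMap_apply_one, AffineMap.lineMap_apply_zero, sub_zero, div_one] at h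
  rw [← neg_sub y x, inner_neg_right]
  linarith

/-- One step of projected gradient descent. -/
theorem IsProjOn.norm_sub_sq_le_of_step {E : Type*} [NormedAddCommGroup E]
    [InnerProductSpace ℝ E] {C : Set E} (hC : Convex ℝ C) {u v p z : E} {η : ℝ}
    (h : IsProjOn C (u - η • v) p) (hz : z ∈ C) :
    2 * η * ⟪v, u - z⟫ ≤ ‖u - z‖ ^ 2 - ‖p - z‖ ^ 2 + η ^ 2 * ‖v‖ ^ 2 := by
  have h1 := pow_le_pow_left₀ (norm_nonneg _) (h.norm_sub_le hC hz) 2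
  rw [sub_right_comm, norm_sub_sq_real (u - z), real_inner_smul_right, norm_smul, mul_pow,
    Real.norm_eq_abs, sq_abs, real_inner_comm] at h1
  linarith

/-- Bound on the squared norm of the primal gradient of the Lagrangian. -/
theorem norm_add_sum_smul_sq_le {E : Type*} [NormedAddCommGroup E] [NormedSpace ℝ E] {m : ℕ}
    {G : ℝ} {u : E} {v : Fin m → E} (hu : ‖u‖ ≤ G) (hv : ∀ i, ‖v i‖ ≤ G)
    (c : EuclideanSpace ℝ (Fin m)) :
    ‖u + ∑ i, c i • v i‖ ^ 2 ≤ (m + 1) * G ^ 2 * (1 + ‖c‖ ^ 2) := by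
  have h1 : ‖u + ∑ i, c i • v i‖ ≤ G * (1 + ∑ i, |c i|) := by
    have hsum : ‖∑ i, c i • v i‖ ≤ ∑ i, |c i| * G :=
      norm_sum_le_of_le _ fun i _ => by
        rw [norm_smul, Real.norm_eq_abs]
        exact mul_le_mul_of_nonneg_left (hv i) (abs_nonneg _)
    rw [← Finset.sum_mul] at hsum
    linarith [norm_add_le u (∑ i, c i • v i)]
  have hcs : (∑ i, |c i|) ^ 2 ≤ m * ‖c‖ ^ 2 := by
    have := sq_sum_le_card_mul_sum_sq (s := Finset.univ) (f := fun i => |c i|)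
    simpa [EuclideanSpace.real_norm_sq_eq] using this
  have hm : (1 + ∑ i, |c i|) ^ 2 ≤ (m + 1) * (1 + ‖c‖ ^ 2) := by
    have hcross : 2 * ∑ i, |c i| ≤ m + ‖c‖ ^ 2 := by
      have := Finset.sum_nonneg fun i (_ : i ∈ Finset.univ) => sq_nonneg (|c i| - 1)
      simp only [sub_sq, sq_abs, mul_one, one_pow, Finset.sum_add_distrib,
        Finset.sum_sub_distrib, ← Finset.mul_sum, Finset.sum_const, Finset.card_univ,
        Fintype.card_fin, nsmul_eq_mul] at this
      rw [EuclideanSpace.real_norm_sq_eq]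
      linarith
    linarith
  calc ‖u + ∑ i, c i • v i‖ ^ 2 ≤ (G * (1 + ∑ i, |c i|)) ^ 2 :=
        pow_le_pow_left₀ (norm_nonneg _) h1 2
    _ = G ^ 2 * (1 + ∑ i, |c i|) ^ 2 := mul_pow _ _ _
    _ ≤ G ^ 2 * ((m + 1) * (1 + ‖c‖ ^ 2)) := mul_le_mul_of_nonneg_left hm (sq_nonneg G)
    _ = (m + 1) * G ^ 2 * (1 + ‖c‖ ^ 2) := by ring

/-- One coordinate of the projected dual ascent step on the regularized Lagrangian. -/
theorem two_mul_dual_gap_le {a D c η μ l : ℝ} (hη : 0 < η) (hc : 0 ≤ c) (hμ : 0 ≤ μ)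
    (ha : |a| ≤ D) :
    2 * η * ((μ * a - c / 2 * μ ^ 2) - (l * a - c / 2 * l ^ 2)) ≤
      (l - μ) ^ 2 - (max 0 (l + η * (a - c * l)) - μ) ^ 2
        + η ^ 2 * (2 * D ^ 2 + 2 * c ^ 2 * l ^ 2) := by
  have hproj : (max 0 (l + η * (a - c * l)) - μ) ^ 2 ≤ (l + η * (a - c * l) - μ) ^ 2 := by
    rcases max_cases 0 (l + η * (a - c * l)) with ⟨h, h'⟩ | ⟨h, _⟩
    · rw [h]; nlinarith
    · rw [h]
  have hsq : (a - c * l) ^ 2 ≤ 2 * D ^ 2 + 2 * c ^ 2 * l ^ 2 := by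
    have := sq_le_sq' (abs_le.1 ha).1 (abs_le.1 ha).2
    nlinarith [sq_nonneg (a + c * l)]
  have hgrad : (μ * a - c / 2 * μ ^ 2) - (l * a - c / 2 * l ^ 2) ≤ (a - c * l) * (μ - l) := by
    nlinarith [mul_nonneg hc (sq_nonneg (μ - l))]
  have h1 := mul_le_mul_of_nonneg_left hgrad (by positivity : 0 ≤ 2 * η)
  have h2 := mul_le_mul_of_nonneg_left hsq (sq_nonneg η)
  linarith

/-- Proposition 1 of the paper.  For the primal-dual iterates of
Algorithm 1 on the convex–concave functions
`L_t(x,λ) = f_t(x) + ∑ i (λ_i g_i(x) − (δη/2) λ_i²)`, the cumulative gap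
`∑_t (L_t(x_t, λ) − L_t(x, λ_t))` is bounded for every `x ∈ B` and `λ ∈ [0,∞)^m`. -/
theorem stmt2 {d m T : ℕ} (R G D η δ : ℝ)
    (hR : 0 < R) (hG : 0 < G) (hD : 0 < D) (hη : 0 < η) (hδ : 0 < δ)
    (g : Fin m → EuclideanSpace ℝ (Fin d) → ℝ)
    (f : ℕ → EuclideanSpace ℝ (Fin d) → ℝ)
    (hgconv : ∀ i, ConvexOn ℝ Set.univ (g i))
    (hfconv : ∀ t, ConvexOn ℝ Set.univ (f t))
    (gg : Fin m → EuclideanSpace ℝ (Fin d) → EuclideanSpace ℝ (Fin d))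
    (gf : ℕ → EuclideanSpace ℝ (Fin d) → EuclideanSpace ℝ (Fin d))
    (hgg : ∀ i x, HasGradientAt (g i) (gg i x) x)
    (hgf : ∀ t x, HasGradientAt (f t) (gf t x) x)
    (hggB : ∀ i, ∀ x ∈ Metric.closedBall (0 : EuclideanSpace ℝ (Fin d)) R, ‖gg i x‖ ≤ G)
    (hgfB : ∀ t, ∀ x ∈ Metric.closedBall (0 : EuclideanSpace ℝ (Fin d)) R, ‖gf t x‖ ≤ G)
    (hgB : ∀ i, ∀ x ∈ Metric.closedBall (0 : EuclideanSpace ℝ (Fin d)) R, |g i x| ≤ D)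
    (hKne : {x : EuclideanSpace ℝ (Fin d) | ∀ i, g i x ≤ 0}.Nonempty)
    (hKB : {x : EuclideanSpace ℝ (Fin d) | ∀ i, g i x ≤ 0} ⊆
      Metric.closedBall (0 : EuclideanSpace ℝ (Fin d)) R)
    (x : ℕ → EuclideanSpace ℝ (Fin d)) (lam : ℕ → EuclideanSpace ℝ (Fin m))
    (hx1 : x 1 = 0) (hlam1 : lam 1 = 0)
    (hxupd : ∀ t, 1 ≤ t →
      IsProjOn (Metric.closedBall (0 : EuclideanSpace ℝ (Fin d)) R)
        (x t - η • (gf t (x t) + ∑ i, lam t i • gg i (x t))) (x (t + 1)))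
    (hlamupd : ∀ t, 1 ≤ t → ∀ i,
      lam (t + 1) i = max 0 (lam t i + η * (g i (x t) - η * δ * lam t i))) :
    ∀ xx ∈ Metric.closedBall (0 : EuclideanSpace ℝ (Fin d)) R,
      ∀ lam' : EuclideanSpace ℝ (Fin m), (∀ i, 0 ≤ lam' i) →
      ∑ t ∈ Finset.Icc 1 T,
          ((f t (x t) + ∑ i, (lam' i * g i (x t) - δ * η / 2 * lam' i ^ 2))
            - (f t xx + ∑ i, (lam t i * g i xx - δ * η / 2 * lam t i ^ 2)))
        ≤ (R ^ 2 + ‖lam'‖ ^ 2) / (2 * η)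
          + η * T / 2 * ((m + 1) * G ^ 2 + 2 * m * D ^ 2)
          + η / 2 * ((m + 1) * G ^ 2 + 2 * m * δ ^ 2 * η ^ 2)
            * ∑ t ∈ Finset.Icc 1 T, ‖lam t‖ ^ 2 := by
  intro xx hxx lam' hlam'
  have hconv : Convex ℝ (Metric.closedBall (0 : EuclideanSpace ℝ (Fin d)) R) :=
    convex_closedBall _ _
  have hxB : ∀ t, 1 ≤ t → x t ∈ Metric.closedBall (0 : EuclideanSpace ℝ (Fin d)) R := by
    intro t ht
    obtain rfl | ⟨s, hs, rfl⟩ : t = 1 ∨ ∃ s, 1 ≤ s ∧ t = s + 1 := by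
      rcases ht.eq_or_lt with h | h
      · exact Or.inl h.symm
      · exact Or.inr ⟨t - 1, by omega, by omega⟩
    · rw [hx1]; exact Metric.mem_closedBall_self hR.le
    · exact (hxupd s hs).1
  have hlam0 : ∀ t, 1 ≤ t → ∀ i, 0 ≤ lam t i := by
    intro t ht i
    obtain rfl | ⟨s, hs, rfl⟩ : t = 1 ∨ ∃ s, 1 ≤ s ∧ t = s + 1 := by
      rcases ht.eq_or_lt with h | h
      · exact Or.inl h.symm
      · exact Or.inr ⟨t - 1, by omega, by omega⟩
    · simp [hlam1]
    · rw [hlamupd s hs i]; exact le_max_left _ _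
  have hprimal : ∀ t, 1 ≤ t →
      2 * η * ((f t (x t) + ∑ i, lam t i * g i (x t)) - (f t xx + ∑ i, lam t i * g i xx)) ≤
        ‖x t - xx‖ ^ 2 - ‖x (t + 1) - xx‖ ^ 2
          + η ^ 2 * ((m + 1) * G ^ 2 * (1 + ‖lam t‖ ^ 2)) := by
    intro t ht
    have hgrad : (f t (x t) + ∑ i, lam t i * g i (x t)) - (f t xx + ∑ i, lam t i * g i xx) ≤
        ⟪gf t (x t) + ∑ i, lam t i • gg i (x t), x t - xx⟫ := by
      have hf := (hfconv t).sub_le_inner_of_hasGradientAt (hgf t (x t)) xx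
      have hg : ∑ i, lam t i * g i (x t) - ∑ i, lam t i * g i xx ≤
          ⟪∑ i, lam t i • gg i (x t), x t - xx⟫ := by
        rw [sum_inner, ← Finset.sum_sub_distrib]
        refine Finset.sum_le_sum fun i _ => ?_
        rw [real_inner_smul_left, ← mul_sub]
        exact mul_le_mul_of_nonneg_left
          ((hgconv i).sub_le_inner_of_hasGradientAt (hgg i (x t)) xx) (hlam0 t ht i)
      rw [inner_add_left]
      linarith
    have hstep := (hxupd t ht).norm_sub_sq_le_of_step hconv hxx
    have hnorm := mul_le_mul_of_nonneg_left
      (norm_add_sum_smul_sq_le (hgfB t _ (hxB t ht)) (fun i => hggB i _ (hxB t ht)) (lam t))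
      (sq_nonneg η)
    have := mul_le_mul_of_nonneg_left hgrad (by positivity : 0 ≤ 2 * η)
    linarith
  have hdual : ∀ t, 1 ≤ t →
      2 * η * (∑ i, (lam' i * g i (x t) - δ * η / 2 * lam' i ^ 2)
          - ∑ i, (lam t i * g i (x t) - δ * η / 2 * lam t i ^ 2)) ≤
        ‖lam t - lam'‖ ^ 2 - ‖lam (t + 1) - lam'‖ ^ 2
          + η ^ 2 * (2 * m * D ^ 2 + 2 * m * δ ^ 2 * η ^ 2 * ‖lam t‖ ^ 2) := by
    intro t ht
    have hsum : 2 * η * (∑ i, (lam' i * g i (x t) - δ * η / 2 * lam' i ^ 2)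
          - ∑ i, (lam t i * g i (x t) - δ * η / 2 * lam t i ^ 2)) ≤
        ‖lam t - lam'‖ ^ 2 - ‖lam (t + 1) - lam'‖ ^ 2
          + η ^ 2 * (m * (2 * D ^ 2) + 2 * (δ * η) ^ 2 * ‖lam t‖ ^ 2) := by
      have hcard : (m : ℝ) * (2 * D ^ 2) = ∑ _i : Fin m, 2 * D ^ 2 := by simp
      rw [hcard]
      simp only [EuclideanSpace.real_norm_sq_eq]
      rw [← Finset.sum_sub_distrib, Finset.mul_sum, ← Finset.sum_sub_distrib, Finset.mul_sum,
        ← Finset.sum_add_distrib, Finset.mul_sum, ← Finset.sum_add_distrib]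
      refine Finset.sum_le_sum fun i _ => ?_
      rw [PiLp.sub_apply, PiLp.sub_apply, hlamupd t ht i, mul_comm η δ]
      exact two_mul_dual_gap_le hη (by positivity) (hlam' i) (hgB i _ (hxB t ht))
    have hm : ‖lam t‖ ^ 2 ≤ m * ‖lam t‖ ^ 2 := by
      rcases Nat.eq_zero_or_pos m with rfl | h
      · simp [EuclideanSpace.real_norm_sq_eq]
      · exact le_mul_of_one_le_left (sq_nonneg _) (by exact_mod_cast h)
    have := mul_le_mul_of_nonneg_left hm (by positivity : 0 ≤ η ^ 2 * (2 * (δ * η) ^ 2))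
    linarith
  have htel : ∀ n : ℕ,
      2 * η * ∑ t ∈ Finset.Icc 1 n,
          ((f t (x t) + ∑ i, (lam' i * g i (x t) - δ * η / 2 * lam' i ^ 2))
            - (f t xx + ∑ i, (lam t i * g i xx - δ * η / 2 * lam t i ^ 2))) ≤
        ‖xx‖ ^ 2 + ‖lam'‖ ^ 2 - (‖x (n + 1) - xx‖ ^ 2 + ‖lam (n + 1) - lam'‖ ^ 2)
          + η ^ 2 * n * ((m + 1) * G ^ 2 + 2 * m * D ^ 2)
          + η ^ 2 * ((m + 1) * G ^ 2 + 2 * m * δ ^ 2 * η ^ 2)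
            * ∑ t ∈ Finset.Icc 1 n, ‖lam t‖ ^ 2 := by
    intro n
    induction n with
    | zero => simp [hx1, hlam1]
    | succ n ih =>
      rw [Finset.sum_Icc_succ_top (by omega), Finset.sum_Icc_succ_top (by omega)]
      have hp := hprimal (n + 1) (by omega)
      have hd := hdual (n + 1) (by omega)
      simp only [Finset.sum_sub_distrib] at hd ih ⊢
      push_cast
      linarith
  have hxxR : ‖xx‖ ^ 2 ≤ R ^ 2 :=
    pow_le_pow_left₀ (norm_nonneg _) (mem_closedBall_zero_iff.1 hxx) 2
  have hT := htel T
  refine le_of_mul_le_mul_left ?_ (by positivity : 0 < 2 * η)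
  have hdiv : 2 * η * ((R ^ 2 + ‖lam'‖ ^ 2) / (2 * η)) = R ^ 2 + ‖lam'‖ ^ 2 :=
    mul_div_cancel₀ _ (by positivity)
  rw [mul_add, mul_add, hdiv]
  linarith [sq_nonneg ‖x (T + 1) - xx‖, sq_nonneg ‖lam (T + 1) - lam'‖]
end

section
/- Let B = {x ∈ ℝ^d : ‖x‖ ≤ R}, let f, g : ℝ^d → ℝ be convex differentiable functions with ‖∇f(x)‖ ≤ G·T for all x ∈ B (for instance f = ∑_{t=1}^T f_t with each f_t G-Lipschitz on B), let γ ≥ 0 and σ > 0, and assume ‖∇g(x)‖ ≥ σ for every x ∈ B with g(x) + γ = 0. Let x_* be a minimizer of f over the nonempty set {x ∈ B : g(x) ≤ 0} and let x_γ be a minimizer of f over the nonempty set {x ∈ B : g(x) ≤ −γ}, and assume the KKT condition holds at x_γ: there exists λ_γ ≥ 0 such that ∇f(x_γ) + λ_γ ∇g(x_γ) = 0 and λ_γ = 0 whenever g(x_γ) + γ < 0. Then |f(x_*) − f(x_γ)| ≤ (G/σ)·γ·T. -/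
open RealInnerProductSpace

/-- A convex function lies above its tangent hyperplanes. -/
theorem ConvexOn.add_inner_gradient_le {E : Type*} [NormedAddCommGroup E]
    [InnerProductSpace ℝ E] [CompleteSpace E] {f : E → ℝ} {f' x : E}
    (hf : ConvexOn ℝ Set.univ f) (hf' : HasGradientAt f f' x) (y : E) :
    f x + inner ℝ f' (y - x) ≤ f y := by
  have hconv : ConvexOn ℝ Set.univ (fun t : ℝ => f (AffineMap.lineMap x y t)) :=
    hf.comp_affineMap (AffineMap.lineMap x y)
  have hderiv : HasDerivAt (fun t : ℝ => f (AffineMap.lineMap x y t))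
      (inner ℝ f' (y - x)) 0 := by
    have hline : HasFDerivAt f (InnerProductSpace.toDual ℝ E f')
        (AffineMap.lineMap x y (0 : ℝ)) := by
      simpa using hf'.hasFDerivAt
    exact hline.comp_hasDerivAt (0 : ℝ) (AffineMap.hasDerivAt_lineMap (a := x) (b := y))
  have hslope := hconv.le_slope_of_hasDerivAt (Set.mem_univ 0) (Set.mem_univ 1)
    zero_lt_one hderiv
  simp only [slope_def_field, AffineMap.lineMap_apply_one, AffineMap.lineMap_apply_zero,
    sub_zero, div_one] at hslope
  linarith

/-- Theorem 3 of the paper. If the minimizer `x_γ` of `f` over the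
tightened feasible set `{x ∈ B : g(x) ≤ −γ}` satisfies the KKT condition, the gradient of
`f` is bounded by `G·T` on `B` and the gradient of `g` has norm at least `σ` on the
boundary `{g = −γ}`, then tightening the constraint changes the optimal value by at most
`(G/σ)·γ·T`. -/
theorem stmt6 {d : ℕ} (R G T γ σ : ℝ)
    (hR : 0 < R) (hG : 0 < G) (hT : 0 < T) (hγ : 0 ≤ γ) (hσ : 0 < σ)
    (f g : EuclideanSpace ℝ (Fin d) → ℝ)
    (hfconv : ConvexOn ℝ Set.univ f) (hgconv : ConvexOn ℝ Set.univ g)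
    (gf gg : EuclideanSpace ℝ (Fin d) → EuclideanSpace ℝ (Fin d))
    (hgf : ∀ x, HasGradientAt f (gf x) x)
    (hgg : ∀ x, HasGradientAt g (gg x) x)
    (hgfB : ∀ x ∈ Metric.closedBall (0 : EuclideanSpace ℝ (Fin d)) R, ‖gf x‖ ≤ G * T)
    (hσB : ∀ x ∈ Metric.closedBall (0 : EuclideanSpace ℝ (Fin d)) R,
      g x + γ = 0 → σ ≤ ‖gg x‖)
    (xstar xγ : EuclideanSpace ℝ (Fin d))
    (hxstar : xstar ∈ Metric.closedBall (0 : EuclideanSpace ℝ (Fin d)) R ∧ g xstar ≤ 0)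
    (hxstarmin : ∀ y ∈ Metric.closedBall (0 : EuclideanSpace ℝ (Fin d)) R,
      g y ≤ 0 → f xstar ≤ f y)
    (hxγ : xγ ∈ Metric.closedBall (0 : EuclideanSpace ℝ (Fin d)) R ∧ g xγ ≤ -γ)
    (hxγmin : ∀ y ∈ Metric.closedBall (0 : EuclideanSpace ℝ (Fin d)) R,
      g y ≤ -γ → f xγ ≤ f y)
    (hKKT : ∃ lamγ : ℝ, 0 ≤ lamγ ∧ gf xγ + lamγ • gg xγ = 0 ∧
      (g xγ + γ < 0 → lamγ = 0)) :
    |f xstar - f xγ| ≤ G / σ * γ * T := by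
  obtain ⟨lam, hlam, hstat, hslack⟩ := hKKT
  have hle : f xstar ≤ f xγ := hxstarmin xγ hxγ.1 (by linarith [hxγ.2])
  have hf := hfconv.add_inner_gradient_le (hgf xγ) xstar
  have hg := hgconv.add_inner_gradient_le (hgg xγ) xstar
  have hgf_eq : gf xγ = -(lam • gg xγ) := eq_neg_of_add_eq_zero_left hstat
  rw [hgf_eq, inner_neg_left, real_inner_smul_left] at hf
  rw [abs_sub_comm, abs_of_nonneg (sub_nonneg.2 hle)]
  rcases lt_or_eq_of_le (show g xγ + γ ≤ 0 by linarith [hxγ.2]) with hlt | heq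
  · have hbound : 0 ≤ G / σ * γ * T := by positivity
    rw [hslack hlt] at hf
    linarith
  · have hnorm : lam * ‖gg xγ‖ ≤ G * T := by
      simpa [hgf_eq, norm_smul, abs_of_nonneg hlam] using hgfB xγ hxγ.1
    have hlam_le : lam ≤ G * T / σ := by
      rw [le_div_iff₀ hσ]
      exact (mul_le_mul_of_nonneg_left (hσB xγ hxγ.1 heq) hlam).trans hnorm
    have hinner : inner ℝ (gg xγ) (xstar - xγ) ≤ γ := by linarith [hxstar.2]
    calc f xγ - f xstar ≤ lam * inner ℝ (gg xγ) (xstar - xγ) := by linarith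
      _ ≤ lam * γ := mul_le_mul_of_nonneg_left hinner hlam
      _ ≤ G * T / σ * γ := mul_le_mul_of_nonneg_right hlam_le hγ
      _ = G / σ * γ * T := by ring
end
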